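/- Let p ≥ 1, let λ = (λ₁,…,λ_p) be nonincreasing nonnegative weights, let γ ≥ 0, and let u ∈ ℝ^p satisfy u₁ ≥ u₂ ≥ … ≥ u_p ≥ 0. For each index j, let I_j = { 1 ≤ i ≤ p : |η_i(u; γ)| = |η_j(u; γ)| } be the tie set of the j-th component of the proximal output. Then for every 1 ≤ j ≤ p, η_j(u; γ) = max( 0, Σ_{i ∈ I_j} (u_i − γλ_i) ) / |I_j|; that is, each component of the SLOPE proximal operator equals the positive part of the average of u_i − γλ_i over its tie set. -/

import Mathlib

open MeasureTheory ProbabilityTheory Filter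

/-- Standard Gaussian measure `N(0, I_n)` on `ℝⁿ`. -/
noncomputable def stdGaussian (n : ℕ) : Measure (Fin n → ℝ) :=
  Measure.pi fun _ => gaussianReal 0 1

/-- The nonincreasing rearrangement of the absolute values of the entries of `x`. -/
noncomputable def sortedAbs {n : ℕ} (x : Fin n → ℝ) : Fin n → ℝ :=
  fun i => |x ((Tuple.sort fun j => -|x j|) i)|

/-- The sorted-ℓ1 (SLOPE) norm `‖x‖_λ = ∑ λ_i |x|_(i)`. -/
noncomputable def slopeNorm {n : ℕ} (lam x : Fin n → ℝ) : ℝ :=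
  ∑ i, lam i * sortedAbs x i

/-- The SLOPE proximal objective `½‖u − v‖₂² + γ‖v‖_λ`. -/
noncomputable def slopeObj {n : ℕ} (lam : Fin n → ℝ) (γ : ℝ) (u v : Fin n → ℝ) : ℝ :=
  (1/2) * ∑ i, (u i - v i)^2 + γ * slopeNorm lam v

/-- `v` is a minimizer of the SLOPE proximal objective, i.e. `v = η(u; γ, λ)`
(the minimizer is unique since the objective is strictly convex). -/
def IsSlopeProx {n : ℕ} (lam : Fin n → ℝ) (γ : ℝ) (u v : Fin n → ℝ) : Prop :=
  ∀ w, slopeObj lam γ u v ≤ slopeObj lam γ u w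

theorem sortedAbs_antitone {n : ℕ} (x : Fin n → ℝ) : Antitone (sortedAbs x) := by
  intro i j h
  have := Tuple.monotone_sort (fun j => -|x j|) h
  simpa [sortedAbs] using this

theorem sortedAbs_nonneg {n : ℕ} (x : Fin n → ℝ) (i : Fin n) : 0 ≤ sortedAbs x i :=
  abs_nonneg _

theorem sortedAbs_of_antitone {n : ℕ} {x : Fin n → ℝ} (hx : Antitone x) (h0 : ∀ i, 0 ≤ x i) :
    sortedAbs x = x := by
  have hm : Monotone fun j => -|x j| := fun i j h => by
    simpa [abs_of_nonneg (h0 _)] using hx h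
  funext i
  simp only [sortedAbs, Tuple.sort_eq_refl_iff_monotone.mpr hm, Equiv.refl_apply,
    abs_of_nonneg (h0 i)]

theorem slopeNorm_of_antitone {n : ℕ} (lam : Fin n → ℝ) {x : Fin n → ℝ} (hx : Antitone x)
    (h0 : ∀ i, 0 ≤ x i) : slopeNorm lam x = ∑ i, lam i * x i := by
  rw [slopeNorm, sortedAbs_of_antitone hx h0]

/-- By the rearrangement inequality, the sorted pairing dominates every other pairing. -/
theorem sum_mul_abs_comp_perm_le_slopeNorm {n : ℕ} {lam : Fin n → ℝ} (hlam : Antitone lam)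
    (x : Fin n → ℝ) (σ : Equiv.Perm (Fin n)) :
    ∑ i, lam i * |x (σ i)| ≤ slopeNorm lam x := by
  have h := (hlam.monovary (sortedAbs_antitone x)).sum_mul_comp_perm_le_sum_mul
    (σ := σ.trans (Tuple.sort fun j => -|x j|).symm)
  simpa [sortedAbs, slopeNorm] using h

theorem slopeNorm_midpoint_le {n : ℕ} {lam : Fin n → ℝ} (hlam : Antitone lam)
    (h0 : ∀ i, 0 ≤ lam i) (x y : Fin n → ℝ) :
    slopeNorm lam (fun i => (x i + y i) / 2) ≤ (slopeNorm lam x + slopeNorm lam y) / 2 := by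
  set σ := Tuple.sort fun j => -|(x j + y j) / 2| with hσ
  have hx := sum_mul_abs_comp_perm_le_slopeNorm hlam x σ
  have hy := sum_mul_abs_comp_perm_le_slopeNorm hlam y σ
  have h : slopeNorm lam (fun i => (x i + y i) / 2) ≤
      ∑ i, (lam i * |x (σ i)| + lam i * |y (σ i)|) / 2 := by
    refine Finset.sum_le_sum fun i _ => ?_
    simp only [sortedAbs, ← hσ]
    rw [← mul_add, mul_div_assoc]
    refine mul_le_mul_of_nonneg_left ?_ (h0 i)
    rw [abs_div, abs_two]
    gcongr
    exact abs_add_le _ _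
  rw [← Finset.sum_div, Finset.sum_add_distrib] at h
  linarith

theorem IsSlopeProx.eq {n : ℕ} {lam : Fin n → ℝ} (hlam : Antitone lam) (h0 : ∀ i, 0 ≤ lam i)
    {γ : ℝ} (hγ : 0 ≤ γ) {u v w : Fin n → ℝ} (hv : IsSlopeProx lam γ u v)
    (hw : IsSlopeProx lam γ u w) : v = w := by
  have h1 := hv fun i => (v i + w i) / 2
  have h2 := hw fun i => (v i + w i) / 2
  have h3 := mul_le_mul_of_nonneg_left (slopeNorm_midpoint_le hlam h0 v w) hγ
  simp only [slopeObj] at h1 h2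
  have h4 : ∑ i, (u i - (v i + w i) / 2) ^ 2 =
      (∑ i, (u i - v i) ^ 2 + ∑ i, (u i - w i) ^ 2) / 2 - (∑ i, (v i - w i) ^ 2) / 4 := by
    rw [← Finset.sum_add_distrib, Finset.sum_div, Finset.sum_div, ← Finset.sum_sub_distrib]
    exact Finset.sum_congr rfl fun i _ => by ring
  have h5 : ∑ i, (v i - w i) ^ 2 = 0 :=
    le_antisymm (by rw [h4] at h1 h2; linarith) (Finset.sum_nonneg fun i _ => sq_nonneg _)
  funext i
  have := (Finset.sum_eq_zero_iff_of_nonneg fun i _ => sq_nonneg (v i - w i)).mp h5 i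
    (Finset.mem_univ i)
  exact sub_eq_zero.mp (pow_eq_zero_iff two_ne_zero |>.mp this)

/-- For a nonincreasing nonnegative input the proximal output is nonincreasing and nonnegative. -/
theorem IsSlopeProx.sortedAbs_eq {n : ℕ} {lam : Fin n → ℝ} (hlam : Antitone lam)
    (h0 : ∀ i, 0 ≤ lam i) {γ : ℝ} (hγ : 0 ≤ γ) {u v : Fin n → ℝ} (hu : Antitone u)
    (hu0 : ∀ i, 0 ≤ u i) (hv : IsSlopeProx lam γ u v) : sortedAbs v = v := by
  refine IsSlopeProx.eq hlam h0 hγ (fun w => le_trans ?_ (hv w)) hv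
  have hnorm : slopeNorm lam (sortedAbs v) = slopeNorm lam v :=
    slopeNorm_of_antitone lam (sortedAbs_antitone v) (sortedAbs_nonneg v)
  have hpair : ∑ i, u i * v i ≤ ∑ i, u i * sortedAbs v i :=
    (Finset.sum_le_sum fun i _ => mul_le_mul_of_nonneg_left (le_abs_self (v i)) (hu0 i)).trans
      (sum_mul_abs_comp_perm_le_slopeNorm hu v 1)
  have hsq : ∑ i, sortedAbs v i ^ 2 = ∑ i, v i ^ 2 := by
    simp only [sortedAbs, sq_abs]
    exact Equiv.sum_comp (Tuple.sort fun j => -|v j|) fun i => v i ^ 2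
  have hexp (x : Fin n → ℝ) : ∑ i, (u i - x i) ^ 2 =
      ∑ i, u i ^ 2 - 2 * ∑ i, u i * x i + ∑ i, x i ^ 2 := by
    rw [Finset.mul_sum, ← Finset.sum_sub_distrib, ← Finset.sum_add_distrib]
    exact Finset.sum_congr rfl fun i _ => by ring
  rw [slopeObj, slopeObj, hnorm, hexp, hexp, hsq]
  linarith

/-- First-order inequality obtained by moving the whole level set `{v = c}` by `t`. -/
theorem IsSlopeProx.mul_sum_le {n : ℕ} {lam : Fin n → ℝ} {γ : ℝ} {u v : Fin n → ℝ}
    (hv : IsSlopeProx lam γ u v) (hanti : Antitone v) (hv0 : ∀ i, 0 ≤ v i) {c t : ℝ}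
    (hct : 0 ≤ c + t) (ht : ∀ i, v i ≠ c → |t| < |v i - c|) :
    t * ∑ i with v i = c, (u i - v i - γ * lam i) ≤
      t ^ 2 / 2 * ((Finset.univ.filter fun i => v i = c).card : ℝ) := by
  set w : Fin n → ℝ := fun i => v i + if v i = c then t else 0 with hw
  have hw0 (i) : 0 ≤ w i := by
    by_cases h : v i = c
    · simpa [hw, h] using hct
    · simpa [hw, h] using hv0 i
  have hwa : Antitone w := by
    intro i k hik
    have := hanti hik
    have hi := ht i
    have hk := ht k
    by_cases h : v i = c <;> by_cases h' : v k = c <;> simp only [hw, h, h', if_true, if_false]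
    · exact le_rfl
    · have := hk h'
      rw [abs_of_nonpos (a := v k - c) (by linarith)] at this
      linarith [neg_abs_le t]
    · have := hi h
      rw [abs_of_nonneg (a := v i - c) (by linarith)] at this
      linarith [le_abs_self t]
    · linarith
  have h := hv w
  rw [slopeObj, slopeObj, slopeNorm_of_antitone lam hanti hv0, slopeNorm_of_antitone lam hwa hw0]
    at h
  have e : (1 / 2) * ∑ i, (u i - w i) ^ 2 + γ * ∑ i, lam i * w i -
      ((1 / 2) * ∑ i, (u i - v i) ^ 2 + γ * ∑ i, lam i * v i) =
      t ^ 2 / 2 * ((Finset.univ.filter fun i => v i = c).card : ℝ) -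
        t * ∑ i with v i = c, (u i - v i - γ * lam i) := by
    rw [Finset.card_eq_sum_ones, Nat.cast_sum, Finset.sum_filter, Finset.sum_filter]
    simp only [Finset.mul_sum, ← Finset.sum_sub_distrib, ← Finset.sum_add_distrib]
    refine Finset.sum_congr rfl fun i _ => ?_
    by_cases h : v i = c
    · simp only [hw, h, if_true]
      push_cast
      ring
    · simp [hw, h]
  linarith

theorem nonpos_of_forall_mul_le_sq {S k δ : ℝ} (hk : 0 < k) (hδ : 0 < δ)
    (h : ∀ t, 0 < t → t < δ → t * S ≤ t ^ 2 / 2 * k) : S ≤ 0 := by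
  by_contra! hS
  have ht : 0 < min (δ / 2) (S / k) := by positivity
  have h1 := h _ ht ((min_le_left _ _).trans_lt (by linarith))
  have h2 : min (δ / 2) (S / k) * k ≤ S := (le_div_iff₀ hk).mp (min_le_right _ _)
  nlinarith

theorem exists_pos_lt_abs_sub {n : ℕ} (v : Fin n → ℝ) (c : ℝ) :
    ∃ δ > 0, ∀ i, v i ≠ c → δ < |v i - c| := by
  have h : ∀ᶠ δ in nhdsWithin (0 : ℝ) (Set.Ioi 0), ∀ i, v i ≠ c → δ < |v i - c| := by
    refine eventually_all.mpr fun i => ?_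
    by_cases hi : v i = c
    · simp [hi]
    · have hpos : 0 < |v i - c| := abs_pos.mpr (sub_ne_zero.mpr hi)
      filter_upwards [Ioo_mem_nhdsGT hpos] with δ hδ _ using hδ.2
  obtain ⟨δ, hδ, hpos⟩ := (h.and self_mem_nhdsWithin).exists
  exact ⟨δ, hpos, hδ⟩

/-- each component of the SLOPE proximal operator equals the
positive part of the average of `u_i − γλ_i` over its tie set
`I_j = { i : |η_i(u;γ)| = |η_j(u;γ)| }`. -/
theorem slope_prox_tie_set_formula
    (p : ℕ) (hp : 1 ≤ p)
    (lam : Fin p → ℝ)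
    (hmono : ∀ i j : Fin p, i ≤ j → lam j ≤ lam i)
    (hnonneg : ∀ i, 0 ≤ lam i)
    (γ : ℝ) (hγ : 0 ≤ γ)
    (u : Fin p → ℝ)
    (hu_mono : ∀ i j : Fin p, i ≤ j → u j ≤ u i)
    (hu_nonneg : ∀ i, 0 ≤ u i)
    (v : Fin p → ℝ) (hv : IsSlopeProx lam γ u v) :
    ∀ j : Fin p,
      v j = max (∑ i ∈ Finset.univ.filter (fun i => |v i| = |v j|), (u i - γ * lam i)) 0
        / ((Finset.univ.filter (fun i => |v i| = |v j|)).card : ℝ) := by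
  have hlam : Antitone lam := fun i j h => hmono i j h
  have hsort := hv.sortedAbs_eq hlam hnonneg hγ (fun i j h => hu_mono i j h) hu_nonneg
  have hanti : Antitone v := hsort ▸ sortedAbs_antitone v
  have hv0 (i) : 0 ≤ v i := hsort ▸ sortedAbs_nonneg v i
  intro j
  simp only [abs_of_nonneg (hv0 _)]
  set k : ℝ := ((Finset.univ.filter fun i => v i = v j).card : ℝ) with hkdef
  have hk : 0 < k := Nat.cast_pos.mpr (Finset.card_pos.mpr ⟨j, by simp⟩)
  have hsum : ∑ i with v i = v j, (u i - γ * lam i) =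
      ∑ i with v i = v j, (u i - v i - γ * lam i) + k * v j := by
    rw [hkdef, ← nsmul_eq_mul, ← Finset.sum_const, ← Finset.sum_add_distrib]
    refine Finset.sum_congr rfl fun i hi => ?_
    rw [(Finset.mem_filter.mp hi).2]
    ring
  obtain ⟨δ, hδ, hgap⟩ := exists_pos_lt_abs_sub v (v j)
  have hle : ∑ i with v i = v j, (u i - v i - γ * lam i) ≤ 0 := by
    refine nonpos_of_forall_mul_le_sq hk hδ fun t ht htδ => ?_
    refine hv.mul_sum_le hanti hv0 (add_nonneg (hv0 j) ht.le) fun i hi => ?_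
    rw [abs_of_pos ht]
    exact htδ.trans (hgap i hi)
  rw [hsum, eq_div_iff hk.ne']
  rcases (hv0 j).eq_or_lt with hj | hj
  · rw [← hj, mul_zero, add_zero, zero_mul, max_eq_right]
    simpa only [← hj] using hle
  · have hge : -∑ i with v i = v j, (u i - v i - γ * lam i) ≤ 0 := by
      refine nonpos_of_forall_mul_le_sq hk (lt_min hδ hj) fun t ht htδ => ?_
      obtain ⟨h1, h2⟩ := lt_min_iff.mp htδ
      have h := hv.mul_sum_le hanti hv0 (c := v j) (t := -t) (by linarith) fun i hi => by
        rw [abs_neg, abs_of_pos ht]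
        exact h1.trans (hgap i hi)
      rwa [neg_sq, neg_mul, ← mul_neg] at h
    rw [le_antisymm hle (by linarith), zero_add, max_eq_left (by positivity), mul_comm]
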